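/- For every bounded pushdown compressor C = (Q, Σ, Γ, δ, ν, q₀, z₀, c) there exists a bounded pushdown compressor C′ = (Q′, Σ, Γ′, δ′, ν′, q₀′, z₀′, 1), performing at most one λ-transition per input symbol, such that C(w) = C′(w) for every w ∈ Σ*. -/

import Mathlib

/-! ### Strings, sequences, gales -/

/-- The length-`n` prefix `S[0..n-1]` of an infinite sequence `S`. -/
def strPrefix {α : Type} (S : ℕ → α) (n : ℕ) : List α := (List.range n).map S

/-- `d` is an `s`-gale over the alphabet `α`:
it is nonnegative and satisfies `d(w) = |Σ|^{-s} * Σ_{a ∈ Σ} d(wa)`. -/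
def IsSGale {α : Type} [Fintype α] (s : ℝ) (d : List α → ℝ) : Prop :=
  (∀ w, 0 ≤ d w) ∧
    ∀ w : List α, d w = (Fintype.card α : ℝ) ^ (-s) * ∑ a : α, d (w ++ [a])

/-- `d` succeeds on the sequence `S`, i.e. `limsup_n d(S[0..n-1]) = ∞`. -/
def succeedsOn {α : Type} (d : List α → ℝ) (S : ℕ → α) : Prop :=
  ∀ C : ℝ, ∃ n : ℕ, C < d (strPrefix S n)

/-! ### Bounded pushdown machinery

Configurations are pairs (state, stack content), the stack written top-first.
`none` as input symbol denotes a `λ`-transition. -/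

/-- One `λ`-transition step on a configuration. -/
def lamStep {α Q Γ : Type} (δ : Q → Option α → Γ → Option (Q × List Γ)) :
    Q × List Γ → Option (Q × List Γ)
  | (_, []) => none
  | (q, a :: v) => (δ q none a).map fun p => (p.1, p.2 ++ v)

/-- `n` consecutive `λ`-transition steps (undefined if any step is undefined). -/
def lamIter {α Q Γ : Type} (δ : Q → Option α → Γ → Option (Q × List Γ)) :
    ℕ → Q × List Γ → Option (Q × List Γ)
  | 0, cfg => some cfg
  | n + 1, cfg => (lamStep δ cfg).bind (lamIter δ n)

/-- Apply `λ`-transitions as long as possible, but at most `n` times. -/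
def lamStar {α Q Γ : Type} (δ : Q → Option α → Γ → Option (Q × List Γ)) :
    ℕ → Q × List Γ → Q × List Γ
  | 0, cfg => cfg
  | n + 1, cfg =>
    match lamStep δ cfg with
    | none => cfg
    | some cfg' => lamStar δ n cfg'

/-- Process one input symbol `b`: first execute the (at most `c`) available
`λ`-transitions, then the transition reading `b`. -/
def symStep {α Q Γ : Type} (δ : Q → Option α → Γ → Option (Q × List Γ)) (c : ℕ)
    (b : α) (cfg : Q × List Γ) : Option (Q × List Γ) :=
  match lamStar δ c cfg with
  | (_, []) => none
  | (q, a :: v) => (δ q (some b) a).map fun p => (p.1, p.2 ++ v)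

/-- The extended transition function: the configuration reached from `cfg`
after processing the input string `w`. -/
def runFrom {α Q Γ : Type} (δ : Q → Option α → Γ → Option (Q × List Γ)) (c : ℕ)
    (cfg : Q × List Γ) (w : List α) : Option (Q × List Γ) :=
  w.foldl (fun o b => o.bind (symStep δ c b)) (some cfg)

/-! ### Bounded pushdown gamblers -/

/-- A bounded pushdown gambler (BPDG) over the input alphabet `α`. -/
structure BPDG (α : Type) [Fintype α] where
  /-- finite set of states -/
  Q : Type
  /-- finite stack alphabet -/
  Γ : Type
  fintypeQ : Fintype Q
  fintypeΓ : Fintype Γ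
  /-- partial transition function; `none` as second argument is a `λ`-transition -/
  δ : Q → Option α → Γ → Option (Q × List Γ)
  /-- betting function: a rational-valued probability measure on `α` for each
  (state, top stack symbol) -/
  β : Q → Γ → α → ℚ
  q0 : Q
  z0 : Γ
  /-- bound on the number of `λ`-transitions per input symbol -/
  c : ℕ
  β_nonneg : ∀ q a b, 0 ≤ β q a b
  β_sum : ∀ q a, ∑ b : α, β q a b = 1
  /-- determinism: a pair (state, top symbol) admits a `λ`-transition or
  input transitions, but not both -/
  det : ∀ q a, δ q none a = none ∨ ∀ b : α, δ q (some b) a = none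
  /-- the bottom symbol `z0` is never removed from the bottom of the stack -/
  bottom : ∀ q (b : Option α), δ q b z0 = none ∨
    ∃ q' v, δ q b z0 = some (q', v ++ [z0])
  /-- no sequence of more than `c` consecutive `λ`-transitions is possible -/
  lamBound : ∀ cfg, lamIter δ (c + 1) cfg = none

namespace BPDG

variable {α : Type} [Fintype α]

/-- The configuration `δ(w)` reached after processing `w` from `(q0, z0)`. -/
def run (G : BPDG α) (w : List α) : Option (G.Q × List G.Γ) :=
  runFrom G.δ G.c (G.q0, [G.z0]) w

/-- The bet placed on symbol `b` in the (possibly undefined) configuration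
`ocfg`: the betting function evaluated at the current state and top stack
symbol (with a fair default bet if the configuration is undefined). -/
noncomputable def betAt (G : BPDG α) (ocfg : Option (G.Q × List G.Γ)) (b : α) : ℝ :=
  match ocfg with
  | some (q, a :: _) => (G.β q a b : ℝ)
  | _ => 1 / (Fintype.card α : ℝ)

/-- The capital after betting on `w`, starting from configuration `ocfg`
with capital 1. -/
noncomputable def martFrom (G : BPDG α) : Option (G.Q × List G.Γ) → List α → ℝ
  | _, [] => 1
  | ocfg, b :: w =>
      (Fintype.card α : ℝ) * G.betAt ocfg b *
        G.martFrom (ocfg.bind (symStep G.δ G.c b)) w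

/-- The martingale `d_G` of the gambler `G`:
`d_G(λ) = 1` and `d_G(wb) = |Σ| d_G(w) β(δ(w))(b)`. -/
noncomputable def mart (G : BPDG α) (w : List α) : ℝ :=
  G.martFrom (some (G.q0, [G.z0])) w

/-- The `s`-gale of `G`: `d^s_G(w) = |Σ|^{(s-1)|w|} d_G(w)`. -/
noncomputable def sgale (G : BPDG α) (s : ℝ) (w : List α) : ℝ :=
  (Fintype.card α : ℝ) ^ ((s - 1) * (w.length : ℝ)) * G.mart w

/-- `G` is nonvanishing if `0 < β(q,z)(b) < 1` for all `q`, `z`, `b`. -/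
def nonvanishing (G : BPDG α) : Prop :=
  ∀ q z b, 0 < G.β q z b ∧ G.β q z b < 1

/-- The number of stack symbols of `G`. -/
def numStackSymbols (G : BPDG α) : ℕ := @Fintype.card G.Γ G.fintypeΓ

end BPDG

/-- The bounded pushdown dimension of a sequence `S`: the infimum of all
`s ∈ [0,∞)` such that some bounded pushdown `s`-gale succeeds on `S`. -/
noncomputable def dimBPD {α : Type} [Fintype α] (S : ℕ → α) : ℝ :=
  sInf {s : ℝ | 0 ≤ s ∧ ∃ G : BPDG α, succeedsOn (G.sgale s) S}

/-! ### Bounded pushdown compressors -/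

/-- A bounded pushdown compressor (BPDC) over the input/output alphabet `α`. -/
structure BPDC (α : Type) [Fintype α] where
  /-- finite set of states -/
  Q : Type
  /-- finite stack alphabet -/
  Γ : Type
  fintypeQ : Fintype Q
  fintypeΓ : Fintype Γ
  /-- partial transition function; `none` as second argument is a `λ`-transition -/
  δ : Q → Option α → Γ → Option (Q × List Γ)
  /-- output function -/
  ν : Q → α → Γ → List α
  q0 : Q
  z0 : Γ
  /-- bound on the number of `λ`-transitions per input symbol -/
  c : ℕ
  det : ∀ q a, δ q none a = none ∨ ∀ b : α, δ q (some b) a = none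
  bottom : ∀ q (b : Option α), δ q b z0 = none ∨
    ∃ q' v, δ q b z0 = some (q', v ++ [z0])
  lamBound : ∀ cfg, lamIter δ (c + 1) cfg = none

namespace BPDC

variable {α : Type} [Fintype α]

/-- The configuration reached after processing `w` from `(q0, z0)`. -/
def run (C : BPDC α) (w : List α) : Option (C.Q × List C.Γ) :=
  runFrom C.δ C.c (C.q0, [C.z0]) w

/-- The output produced on reading symbol `b` in configuration `ocfg`. -/
def outAt (C : BPDC α) (ocfg : Option (C.Q × List C.Γ)) (b : α) : List α :=
  match ocfg with
  | some (q, a :: _) => C.ν q b a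
  | _ => []

/-- The output produced on input `w` starting from configuration `ocfg`. -/
def outFrom (C : BPDC α) : Option (C.Q × List C.Γ) → List α → List α
  | _, [] => []
  | ocfg, b :: w =>
      C.outAt ocfg b ++ C.outFrom (ocfg.bind (symStep C.δ C.c b)) w

/-- The output `C(w)` of the compressor on input `w`. -/
def output (C : BPDC α) (w : List α) : List α :=
  C.outFrom (some (C.q0, [C.z0])) w

/-- The output `ν(q, w, z)` produced on input `w` from state `q` with stack
content `z`. -/
def outputFrom (C : BPDC α) (q : C.Q) (z : List C.Γ) (w : List α) : List α :=
  C.outFrom (some (q, z)) w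

/-- `C` is information-lossless: `w ↦ (C(w), final state)` is one-to-one. -/
def IL (C : BPDC α) : Prop :=
  Function.Injective fun w : List α => (C.output w, (C.run w).map Prod.fst)

/-- The compression ratio of `C` on `S`: `liminf_n |C(S[0..n-1])| / n`. -/
noncomputable def compRatio (C : BPDC α) (S : ℕ → α) : ℝ :=
  Filter.liminf (fun n : ℕ => ((C.output (strPrefix S n)).length : ℝ) / n)
    Filter.atTop

/-- The number `|Q|` of states of `C`. -/
def numStates (C : BPDC α) : ℕ := @Fintype.card C.Q C.fintypeQ

/-- The number of stack symbols of `C`. -/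
def numStackSymbols (C : BPDC α) : ℕ := @Fintype.card C.Γ C.fintypeΓ

/-- The maximum length of any output of `ν` on a single input symbol. -/
def maxOut (C : BPDC α) : ℕ :=
  letI := C.fintypeQ
  letI := C.fintypeΓ
  Finset.univ.sup fun p : C.Q × α × C.Γ => (C.ν p.1 p.2.1 p.2.2).length

end BPDC

/-- The bounded pushdown compression ratio of `S`: the infimum of the
compression ratios achieved on `S` by information-lossless BPD compressors. -/
noncomputable def rhoBPD {α : Type} [Fintype α] (S : ℕ → α) : ℝ :=
  sInf {r : ℝ | ∃ C : BPDC α, C.IL ∧ C.compRatio S = r}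

/-! ### Finite-state gamblers -/

/-- A finite-state gambler over the alphabet `α`. -/
structure FSG (α : Type) [Fintype α] where
  /-- finite set of states -/
  Q : Type
  fintypeQ : Fintype Q
  δ : Q → α → Q
  β : Q → α → ℚ
  q0 : Q
  β_nonneg : ∀ q b, 0 ≤ β q b
  β_sum : ∀ q, ∑ b : α, β q b = 1

namespace FSG

variable {α : Type} [Fintype α]

/-- Capital after betting on `w` from state `q` with capital 1. -/
noncomputable def martFrom (G : FSG α) : G.Q → List α → ℝ
  | _, [] => 1
  | q, b :: w => (Fintype.card α : ℝ) * (G.β q b : ℝ) * G.martFrom (G.δ q b) w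

/-- The martingale of the finite-state gambler `G`. -/
noncomputable def mart (G : FSG α) (w : List α) : ℝ := G.martFrom G.q0 w

/-- The `s`-gale of `G`: `d^s_G(w) = |Σ|^{(s-1)|w|} d_G(w)`. -/
noncomputable def sgale (G : FSG α) (s : ℝ) (w : List α) : ℝ :=
  (Fintype.card α : ℝ) ^ ((s - 1) * (w.length : ℝ)) * G.mart w

end FSG

/-- Finite-state dimension of a sequence `S`. -/
noncomputable def dimFS {α : Type} [Fintype α] (S : ℕ → α) : ℝ :=
  sInf {s : ℝ | 0 ≤ s ∧ ∃ G : FSG α, succeedsOn (G.sgale s) S}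

/-! ### The Lempel-Ziv algorithm (over the binary alphabet) -/

/-- Greedy LZ78 parsing: the next phrase is the shortest nonempty prefix of the
remaining input that is not already a phrase in the dictionary (the empty
phrase `x₀ = λ` is implicitly in the dictionary); a final repeated phrase is
allowed. `fuel` is an upper bound on the number of phrases. -/
def lzParseAux : ℕ → List Bool → List (List Bool) → List (List Bool)
  | 0, rest, _ => if rest = [] then [] else [rest]
  | fuel + 1, rest, dict =>
    if rest = [] then []
    else
      match ((List.range rest.length).map fun i => rest.take (i + 1)).find?
          (fun p => !dict.contains p) with
      | none => [rest]
      | some p => p :: lzParseAux fuel (rest.drop p.length) (dict ++ [p])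

/-- The LZ78 parsing of `x` into phrases. -/
def lzParse (x : List Bool) : List (List Bool) := lzParseAux x.length x []

/-- The length of the LZ output on `x`: the `i`-th phrase (1-indexed) is encoded
by a code for the index `l(i) < i` of its longest proper prefix among the earlier
phrases, taking `⌈log₂ i⌉` bits, plus one bit for the new symbol. -/
def lzLen (x : List Bool) : ℕ :=
  ∑ i ∈ Finset.range (lzParse x).length, (Nat.clog 2 (i + 1) + 1)

/-- The LZ compression ratio of a sequence `S`. -/
noncomputable def rhoLZ (S : ℕ → Bool) : ℝ :=
  Filter.liminf (fun n : ℕ => (lzLen (strPrefix S n) : ℝ) / n) Filter.atTop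

namespace OneLam

/-- Append `s` to the bottom of the stack of a configuration. -/
def app {Q Γ : Type} (s : List Γ) (p : Q × List Γ) : Q × List Γ := (p.1, p.2 ++ s)

/-- Stack symbols below depth `n` are not affected by `n` `λ`-transitions. -/
theorem lamStar_app {α Q Γ : Type} (δ : Q → Option α → Γ → Option (Q × List Γ))
    (s : List Γ) (n : ℕ) : ∀ (q : Q) (x : List Γ), n ≤ x.length →
      lamStar δ n (q, x ++ s) = app s (lamStar δ n (q, x)) ∧
        x.length ≤ (lamStar δ n (q, x)).2.length + n := by
  induction n with
  | zero => intro q x _; simp [lamStar, app]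
  | succ n ih =>
    intro q x hx
    cases x with
    | nil => simp at hx
    | cons a v =>
      simp only [List.length_cons, Nat.add_le_add_iff_right] at hx
      cases h : δ q none a with
      | none => simp [lamStar, lamStep, app, h]
      | some p =>
        have h2 := ih p.1 (p.2 ++ v) (by simp; omega)
        simp only [List.append_assoc] at h2
        simp only [lamStar, lamStep, List.cons_append, h, Option.map_some]
        refine ⟨h2.1, ?_⟩
        have h3 := h2.2
        simp only [List.length_append, List.length_cons] at h3 ⊢
        omega

/-- Processing one symbol only touches the top `c + 1` stack symbols. -/
theorem symStep_app {α Q Γ : Type} (δ : Q → Option α → Γ → Option (Q × List Γ))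
    (s : List Γ) (c : ℕ) (b : α) (q : Q) (x : List Γ) (hx : c + 1 ≤ x.length) :
    symStep δ c b (q, x ++ s) = (symStep δ c b (q, x)).map (app s) := by
  obtain ⟨h1, h2⟩ := lamStar_app δ s c q x (by omega)
  unfold symStep
  rw [h1]
  generalize lamStar δ c (q, x) = r at h2
  obtain ⟨q', y⟩ := r
  cases y with
  | nil => simp at h2; omega
  | cons a v =>
    cases h : δ q' (some b) a <;> simp [app, h]

/-- Every word splits into a short buffer and blocks of length exactly `K`. -/
theorem exists_split {Γ : Type} (K : ℕ) (hK : 0 < K) (y : List Γ) :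
    ∃ p : {l : List Γ // l.length < K} × List {l : List Γ // l.length = K},
      y = p.1.1 ++ (p.2.map Subtype.val).flatten := by
  induction y with
  | nil => exact ⟨(⟨[], hK⟩, []), by simp⟩
  | cons a y ih =>
    obtain ⟨⟨⟨u, hu⟩, bs⟩, rfl⟩ := ih
    by_cases h : u.length + 1 < K
    · exact ⟨(⟨a :: u, by simpa using h⟩, bs), by simp⟩
    · exact ⟨(⟨[], hK⟩, ⟨a :: u, by simp only [List.length_cons]; omega⟩ :: bs), by simp⟩

/-- A chosen splitting. -/
noncomputable def split {Γ : Type} (K : ℕ) (hK : 0 < K) (y : List Γ) :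
    {l : List Γ // l.length < K} × List {l : List Γ // l.length = K} :=
  (exists_split K hK y).choose

theorem split_spec {Γ : Type} (K : ℕ) (hK : 0 < K) (y : List Γ) :
    y = (split K hK y).1.1 ++ ((split K hK y).2.map Subtype.val).flatten :=
  (exists_split K hK y).choose_spec

section
variable {α : Type} [Fintype α] (C : BPDC α)

/-- States of the simulating compressor: a state of `C` and a buffer. -/
abbrev St : Type := C.Q × {l : List C.Γ // l.length < C.c + 2}

/-- Stack symbols: blocks of length `c + 2`, or the bottom marker `none`. -/
abbrev Sy : Type := Option {l : List C.Γ // l.length = C.c + 2}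

/-- The word represented by a stack symbol. -/
def dec : Sy C → List C.Γ
  | none => []
  | some B => B.1

/-- What is always pushed back below: only the bottom marker. -/
def tail : Sy C → List (Sy C)
  | none => [none]
  | some _ => []

/-- Real-time transition function. -/
noncomputable def tr : St C → Option α → Sy C → Option (St C × List (Sy C))
  | _, none, _ => none
  | (q, u), some b, B =>
    (symStep C.δ C.c b (q, u.1 ++ dec C B)).map fun p =>
      ((p.1, (split (C.c + 2) (by omega) p.2).1),
        (split (C.c + 2) (by omega) p.2).2.map some ++ tail C B)

/-- The simulating compressor. -/
noncomputable def sim : BPDC α where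
  Q := St C
  Γ := Sy C
  fintypeQ := by
    haveI := C.fintypeQ
    haveI := C.fintypeΓ
    haveI : Finite {l : List C.Γ // l.length < C.c + 2} :=
      (List.finite_length_lt C.Γ (C.c + 2)).to_subtype
    exact Fintype.ofFinite _
  fintypeΓ := by
    haveI := C.fintypeΓ
    haveI : Finite {l : List C.Γ // l.length = C.c + 2} :=
      (List.finite_length_eq C.Γ (C.c + 2)).to_subtype
    exact Fintype.ofFinite _
  δ := tr C
  ν := fun p b B => C.outAt (some (p.1, p.2.1 ++ dec C B)) b
  q0 := (C.q0, ⟨[C.z0], by simp⟩)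
  z0 := none
  c := 1
  det := fun _ _ => Or.inl rfl
  bottom := by
    rintro ⟨q, u⟩ (_ | b)
    · exact Or.inl rfl
    · cases h : symStep C.δ C.c b (q, u.1 ++ dec C none) with
      | none => left; simp [tr, h]
      | some p => right; simp [tr, h, tail]
  lamBound := by
    rintro ⟨q, _ | ⟨a, v⟩⟩ <;> simp [lamIter, lamStep, tr]

/-- The output of the simulating compressor, with unfolded configuration type. -/
noncomputable def simOut (o : Option (St C × List (Sy C))) (w : List α) : List α :=
  (sim C).outFrom o w

theorem simOut_nil (o : Option (St C × List (Sy C))) : simOut C o [] = [] := rfl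

theorem simOut_cons (q : C.Q) (u : {l : List C.Γ // l.length < C.c + 2}) (B : Sy C)
    (v : List (Sy C)) (b : α) (w : List α) :
    simOut C (some ((q, u), B :: v)) (b :: w) =
      C.outAt (some (q, u.1 ++ dec C B)) b ++
        simOut C ((tr C (q, u) (some b) B).map fun r => (r.1, r.2 ++ v)) w := rfl

theorem outFrom_none (D : BPDC α) (w : List α) : D.outFrom none w = [] := by
  induction w with
  | nil => rfl
  | cons b w ih => simpa [BPDC.outFrom, BPDC.outAt] using ih

theorem simOut_none (w : List α) : simOut C none w = [] := outFrom_none (sim C) w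

theorem outAt_append (q : C.Q) (x s : List C.Γ) (hx : x ≠ []) (b : α) :
    C.outAt (some (q, x ++ s)) b = C.outAt (some (q, x)) b := by
  cases x with
  | nil => exact absurd rfl hx
  | cons a v => rfl

theorem sim_correct (w : List α) : ∀ (q : C.Q) (u : {l : List C.Γ // l.length < C.c + 2})
    (bs : List {l : List C.Γ // l.length = C.c + 2}),
    C.outFrom (some (q, u.1 ++ (bs.map Subtype.val).flatten)) w =
      simOut C (some ((q, u), bs.map some ++ [none])) w := by
  induction w with
  | nil => intro q u bs; rfl
  | cons b w ih =>
    intro q u bs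
    cases bs with
    | nil =>
      simp only [BPDC.outFrom, List.map_nil, List.flatten_nil, List.nil_append, Option.bind_some]
      rw [simOut_cons]
      congr 1
      cases h : symStep C.δ C.c b (q, u.1 ++ []) with
      | none => simp only [tr, h, dec, Option.map_none, outFrom_none, simOut_none]
      | some p =>
        have e := ih p.1 (split (C.c + 2) (by omega) p.2).1 (split (C.c + 2) (by omega) p.2).2
        rw [← split_spec] at e
        simp only [tr, h, dec, tail, Option.map_some]
        rw [List.append_nil]
        exact e
    | cons B bs =>
      have hB : C.c + 1 ≤ (u.1 ++ B.1).length := by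
        have := B.2
        simp only [List.length_append]; omega
      simp only [BPDC.outFrom, List.map_cons, List.flatten_cons, List.cons_append,
        Option.bind_some]
      rw [← List.append_assoc, outAt_append _ _ _ _ (by intro h; simp [h] at hB),
        symStep_app _ _ _ _ _ _ hB, simOut_cons]
      congr 1
      cases h : symStep C.δ C.c b (q, u.1 ++ B.1) with
      | none => simp only [tr, h, dec, Option.map_none, outFrom_none, simOut_none]
      | some p =>
        have e := ih p.1 (split (C.c + 2) (by omega) p.2).1
          ((split (C.c + 2) (by omega) p.2).2 ++ bs)
        rw [List.map_append, List.flatten_append, ← List.append_assoc, ← split_spec] at e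
        simp only [tr, h, dec, tail, app, Option.map_some, List.append_nil]
        rw [e, List.map_append, List.append_assoc]

end

end OneLam

/-- For every bounded pushdown compressor `C` there is a
bounded pushdown compressor `C'` performing at most one `λ`-transition per
input symbol such that `C(w) = C'(w)` for every `w ∈ Σ*`. -/
theorem bpdc_one_lambda_transition {α : Type} [Fintype α]
    (hα : 2 ≤ Fintype.card α) (C : BPDC α) :
    ∃ C' : BPDC α, C'.c = 1 ∧ ∀ w : List α, C.output w = C'.output w := by
  refine ⟨OneLam.sim C, rfl, fun w => ?_⟩
  have h := OneLam.sim_correct C w C.q0 ⟨[C.z0], by simp⟩ []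
  exact h
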